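/- For μ-almost every x ∈ X = supp(μ), the upper local dimension equals d̄(μ,x) = H(q)/log B. -/

import Mathlib

open MeasureTheory Filter Set Metric Topology

/-- `moranCyl c w n (x, ℓ)` refines the interval `[x, x + ℓ]` along the binary word `w`,
using the contraction ratio `c k` at step `k` (the first letter of `w` is processed with
index `n`).  The result `(x', ℓ')` describes the interval `[x', x' + ℓ']`. -/
noncomputable def moranCyl (c : ℕ → ℝ) : List Bool → ℕ → ℝ × ℝ → ℝ × ℝ
  | [], _, st => st
  | bb :: w, n, st =>
      moranCyl c w (n + 1)
        (if bb then (st.1 + st.2 - st.2 / c n, st.2 / c n) else (st.1, st.2 / c n))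

/-- The basic interval `I_w` of the Moran construction with ratios `c`. -/
noncomputable def moranI (c : ℕ → ℝ) (w : List Bool) : Set ℝ :=
  Icc (moranCyl c w 1 (0, 1)).1 ((moranCyl c w 1 (0, 1)).1 + (moranCyl c w 1 (0, 1)).2)

/-- The length `|I_w|` of the basic interval `I_w`. -/
noncomputable def moranLen (c : ℕ → ℝ) (w : List Bool) : ℝ :=
  (moranCyl c w 1 (0, 1)).2

/-- The Moran set `⋂ n ⋃ {I_w : |w| = n}`. -/
noncomputable def moranSet (c : ℕ → ℝ) : Set ℝ :=
  ⋂ n : ℕ, ⋃ w ∈ {w : List Bool | w.length = n}, moranI c w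

/-- The mass assigned to the cylinder `I_w` by the Moran measure with weight `r k` for the
letter at step `k`: `cylMass r w 1 1 = μ(I_w)`. -/
noncomputable def cylMass (r : ℕ → ℝ) : List Bool → ℕ → ℝ → ℝ
  | [], _, m => m
  | bb :: w, n, m => cylMass r w (n + 1) (if bb then (1 - r n) * m else r n * m)

/-- Lower local dimension `liminf_{r → 0⁺} log μ(B(x,r)) / log r`. -/
noncomputable def lowerLocalDim (μ : Measure ℝ) (x : ℝ) : ℝ :=
  liminf (fun rr : ℝ => Real.log (μ (closedBall x rr)).toReal / Real.log rr) (𝓝[>] 0)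

/-- Upper local dimension `limsup_{r → 0⁺} log μ(B(x,r)) / log r`. -/
noncomputable def upperLocalDim (μ : Measure ℝ) (x : ℝ) : ℝ :=
  limsup (fun rr : ℝ => Real.log (μ (closedBall x rr)).toReal / Real.log rr) (𝓝[>] 0)

/-- `betaFn ρ C s = -log (ρ^s + (1-ρ)^s) / log C`; so `β₁ = betaFn p A`, `β₂ = betaFn q B`. -/
noncomputable def betaFn (ρ C : ℝ) (s : ℝ) : ℝ :=
  -Real.log (ρ ^ s + (1 - ρ) ^ s) / Real.log C

/-- The Legendre transform `f^*(α) = inf_s (s α - f(s))`. -/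
noncomputable def legendre (f : ℝ → ℝ) (α : ℝ) : ℝ :=
  ⨅ s : ℝ, (s * α - f s)

/-- The modification `β̃₁` of `β₁`, linear on `(0,1)`. -/
noncomputable def betaTilde1 (ρ C : ℝ) (s : ℝ) : ℝ :=
  if s ≤ 0 ∨ 1 ≤ s then betaFn ρ C s
  else (1 - s) * betaFn ρ C 0 + s * betaFn ρ C 1

/-- `packSup μ X r s` is the supremum of `∑ᵢ μ(B(xᵢ,r))^s` over all finite families of
pairwise disjoint closed balls of radius `r` with centers in `X`. -/
noncomputable def packSup (μ : Measure ℝ) (X : Set ℝ) (rr s : ℝ) : ℝ :=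
  sSup {y : ℝ | ∃ t : Finset ℝ, (↑t : Set ℝ) ⊆ X ∧
    (↑t : Set ℝ).Pairwise (fun u v => Disjoint (closedBall u rr) (closedBall v rr)) ∧
    y = ∑ u ∈ t, (μ (closedBall u rr)).toReal ^ s}

/-- The finite set of binary words of length `n`. -/
def binaryWords : ℕ → Finset (List Bool)
  | 0 => {[]}
  | n + 1 => (binaryWords n).image (List.cons false) ∪ (binaryWords n).image (List.cons true)

lemma mem_binaryWords {n : ℕ} {w : List Bool} : w ∈ binaryWords n ↔ w.length = n := by
  induction n generalizing w with
  | zero => simp [binaryWords]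
  | succ n ih =>
    cases w with
    | nil => simp [binaryWords]
    | cons b w => cases b <;> simp [binaryWords, ih]

lemma sum_binaryWords_succ (n : ℕ) (f : List Bool → ℝ) :
    ∑ w ∈ binaryWords (n + 1), f w =
      ∑ w ∈ binaryWords n, f (false :: w) + ∑ w ∈ binaryWords n, f (true :: w) := by
  rw [binaryWords, Finset.sum_union, Finset.sum_image, Finset.sum_image]
  · intro a _ b _ h; simpa using h
  · intro a _ b _ h; simpa using h
  · rw [Finset.disjoint_left]
    intro w hw hw'
    simp only [Finset.mem_image] at hw hw'
    obtain ⟨a, -, rfl⟩ := hw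
    obtain ⟨b, -, hb⟩ := hw'
    simp at hb

lemma cylMass_pos {r : ℕ → ℝ} (hr : ∀ n, 1 ≤ n → 0 < r n ∧ r n < 1) (w : List Bool) :
    ∀ (n : ℕ) (m : ℝ), 1 ≤ n → 0 < m → 0 < cylMass r w n m := by
  induction w with
  | nil => intro n m _ hm; simpa [cylMass] using hm
  | cons b w ih =>
    intro n m hn hm
    have := hr n hn
    refine ih _ _ (by omega) ?_
    split_ifs
    · exact mul_pos (by linarith) hm
    · exact mul_pos this.1 hm

lemma sum_cylMass_rpow {r : ℕ → ℝ} (hr : ∀ n, 1 ≤ n → 0 < r n ∧ r n < 1) (s : ℝ) (k : ℕ) :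
    ∀ (n : ℕ) (m : ℝ), 1 ≤ n → 0 < m →
      ∑ w ∈ binaryWords k, cylMass r w n m ^ s =
        m ^ s * ∏ j ∈ Finset.range k, (r (n + j) ^ s + (1 - r (n + j)) ^ s) := by
  induction k with
  | zero => intro n m _ _; simp [binaryWords, cylMass]
  | succ k ih =>
    intro n m hn hm
    have h := hr n hn
    have h1 : 0 < 1 - r n := by linarith
    simp only [sum_binaryWords_succ, cylMass, if_true, Bool.false_eq_true, if_false]
    rw [ih _ _ (by omega) (mul_pos h.1 hm), ih _ _ (by omega) (mul_pos h1 hm),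
      Finset.prod_range_succ', Real.mul_rpow h.1.le hm.le, Real.mul_rpow h1.le hm.le]
    have : ∀ j, n + 1 + j = n + (j + 1) := fun j => by ring
    simp only [this, add_zero]
    ring

lemma rpow_one_add_sum_le {ρ x s : ℝ} (hρ : 0 < ρ) (h1 : ρ ≤ x) (h2 : x ≤ 1 - ρ)
    (hs : |s| * -Real.log ρ ≤ 1) :
    x ^ (1 + s) + (1 - x) ^ (1 + s) ≤
      Real.exp (-(s * Real.binEntropy x) + s ^ 2 * Real.log ρ ^ 2) := by
  have key : ∀ y, ρ ≤ y → y ≤ 1 - ρ →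
      y ^ (1 + s) ≤ y * (1 + s * Real.log y + s ^ 2 * Real.log ρ ^ 2) := by
    intro y hy1 hy2
    have hy0 : 0 < y := hρ.trans_le hy1
    have hl1 : Real.log ρ ≤ Real.log y := Real.log_le_log hρ hy1
    have hl2 : Real.log y ≤ 0 := Real.log_nonpos hy0.le (by linarith)
    have habs : |Real.log y| ≤ -Real.log ρ := by rw [abs_of_nonpos hl2]; linarith
    have hb : |s * Real.log y| ≤ 1 := by
      rw [abs_mul]
      exact (mul_le_mul_of_nonneg_left habs (abs_nonneg s)).trans hs
    have he := (abs_le.1 (Real.abs_exp_sub_one_sub_id_le hb)).2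
    have hsq : Real.log y ^ 2 ≤ Real.log ρ ^ 2 := by nlinarith
    rw [Real.rpow_add hy0, Real.rpow_one, Real.rpow_def_of_pos hy0, mul_comm (Real.log y) s]
    refine mul_le_mul_of_nonneg_left ?_ hy0.le
    have : (s * Real.log y) ^ 2 ≤ s ^ 2 * Real.log ρ ^ 2 := by
      rw [mul_pow]; exact mul_le_mul_of_nonneg_left hsq (sq_nonneg s)
    linarith
  have ha := key x h1 h2
  have hb := key (1 - x) (by linarith) (by linarith)
  have he := Real.add_one_le_exp (-(s * Real.binEntropy x) + s ^ 2 * Real.log ρ ^ 2)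
  refine le_trans (le_trans (add_le_add ha hb) (le_of_eq ?_)) he
  simp only [Real.binEntropy, Real.log_inv]
  ring

/-- The entropy of the first `n` letters of the Moran measure with weights `r`. -/
noncomputable def entropySum (r : ℕ → ℝ) (n : ℕ) : ℝ :=
  ∑ k ∈ Finset.range n, Real.binEntropy (r (1 + k))

/-- The logarithmic length `-log |I_w|` of the words `w` of length `n`. -/
noncomputable def logLen (c : ℕ → ℝ) (n : ℕ) : ℝ :=
  ∑ k ∈ Finset.range n, Real.log (c (1 + k))

lemma sum_cylMass_deviation_le {r : ℕ → ℝ} {ρ s ε : ℝ} (hρ : 0 < ρ)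
    (hr : ∀ n, 1 ≤ n → ρ ≤ r n ∧ r n ≤ 1 - ρ) (hs : |s| * -Real.log ρ ≤ 1) (n : ℕ) :
    ∑ w ∈ binaryWords n with
        |s| * (ε * n) ≤ s * (Real.log (cylMass r w 1 1) + entropySum r n), cylMass r w 1 1 ≤
      Real.exp (s ^ 2 * Real.log ρ ^ 2 - |s| * ε) ^ n := by
  have hr' : ∀ n, 1 ≤ n → 0 < r n ∧ r n < 1 := fun n hn => by
    have := hr n hn; constructor <;> linarith
  have hpos : ∀ w, 0 < cylMass r w 1 1 := fun w => cylMass_pos hr' w 1 1 le_rfl one_pos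
  set K := Real.exp (s * entropySum r n - |s| * (ε * n)) with hK
  calc _ ≤ ∑ w ∈ binaryWords n with
        |s| * (ε * n) ≤ s * (Real.log (cylMass r w 1 1) + entropySum r n),
          cylMass r w 1 1 ^ (1 + s) * K := by
        refine Finset.sum_le_sum fun w hw => ?_
        rw [Finset.mem_filter] at hw
        rw [Real.rpow_add (hpos w), Real.rpow_one, Real.rpow_def_of_pos (hpos w), mul_assoc,
          hK, ← Real.exp_add]
        refine le_mul_of_one_le_right (hpos w).le (Real.one_le_exp ?_)
        linarith [hw.2]
    _ ≤ ∑ w ∈ binaryWords n, cylMass r w 1 1 ^ (1 + s) * K :=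
        Finset.sum_le_sum_of_subset_of_nonneg (Finset.filter_subset _ _) fun w _ _ =>
          mul_nonneg (Real.rpow_nonneg (hpos w).le _) (Real.exp_pos _).le
    _ = (∏ j ∈ Finset.range n, (r (1 + j) ^ (1 + s) + (1 - r (1 + j)) ^ (1 + s))) * K := by
        rw [← Finset.sum_mul, sum_cylMass_rpow hr' _ _ _ _ le_rfl one_pos]; simp
    _ ≤ (∏ j ∈ Finset.range n,
          Real.exp (-(s * Real.binEntropy (r (1 + j))) + s ^ 2 * Real.log ρ ^ 2)) * K := by
        refine mul_le_mul_of_nonneg_right (Finset.prod_le_prod (fun j _ => ?_) fun j _ => ?_)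
          (Real.exp_pos _).le
        · have := hr' (1 + j) (by omega)
          exact add_nonneg (Real.rpow_nonneg this.1.le _)
            (Real.rpow_nonneg (by linarith) _)
        · have := hr (1 + j) (by omega)
          exact rpow_one_add_sum_le hρ this.1 this.2 hs
    _ = _ := by
        rw [← Real.exp_sum, hK, ← Real.exp_add, ← Real.exp_nat_mul]
        congr 1
        rw [Finset.sum_add_distrib, Finset.sum_neg_distrib, ← Finset.mul_sum, ← entropySum]
        simp
        ring

lemma moranCyl_snd {c : ℕ → ℝ} (hc : ∀ n, 1 ≤ n → 0 < c n) (w : List Bool) :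
    ∀ (n : ℕ) (st : ℝ × ℝ), 1 ≤ n → (moranCyl c w n st).2 =
      st.2 * Real.exp (-∑ k ∈ Finset.range w.length, Real.log (c (n + k))) := by
  induction w with
  | nil => intro n st _; simp [moranCyl]
  | cons b w ih =>
    intro n st hn
    have hs : (moranCyl c (b :: w) n st).2 =
        st.2 / c n * Real.exp (-∑ k ∈ Finset.range w.length, Real.log (c (n + 1 + k))) := by
      rw [moranCyl, ih _ _ (by omega)]
      split_ifs <;> rfl
    have : ∀ j, n + 1 + j = n + (j + 1) := fun j => by ring
    rw [hs, List.length_cons, Finset.sum_range_succ', neg_add, Real.exp_add, add_zero,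
      Real.exp_neg (Real.log (c n)), Real.exp_log (hc n hn)]
    simp only [this]
    ring

lemma moranLen_eq {c : ℕ → ℝ} (hc : ∀ n, 1 ≤ n → 0 < c n) (w : List Bool) :
    (moranCyl c w 1 (0, 1)).2 = Real.exp (-logLen c w.length) := by
  rw [moranCyl_snd hc w 1 _ le_rfl, one_mul, logLen]

lemma moranCyl_subset {c : ℕ → ℝ} (hc : ∀ n, 1 ≤ n → 2 < c n) (w : List Bool) :
    ∀ (n : ℕ) (st : ℝ × ℝ), 1 ≤ n → 0 ≤ st.2 →
      st.1 ≤ (moranCyl c w n st).1 ∧ 0 ≤ (moranCyl c w n st).2 ∧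
        (moranCyl c w n st).1 + (moranCyl c w n st).2 ≤ st.1 + st.2 := by
  induction w with
  | nil => intro n st _ h; simpa [moranCyl] using h
  | cons b w ih =>
    intro n st hn hst
    have h2 := hc n hn
    have h0 : 0 ≤ st.2 / c n := div_nonneg hst (by linarith)
    have h1 : st.2 / c n ≤ st.2 := div_le_self hst (by linarith)
    cases b
    · have := ih (n + 1) (st.1, st.2 / c n) (by omega) h0
      simp only [moranCyl, Bool.false_eq_true, if_false] at this ⊢
      exact ⟨this.1, this.2.1, by linarith⟩
    · have := ih (n + 1) (st.1 + st.2 - st.2 / c n, st.2 / c n) (by omega) h0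
      simp only [moranCyl, if_true] at this ⊢
      exact ⟨by linarith, this.2.1, by linarith⟩

lemma moranCyl_separated {c : ℕ → ℝ} {B : ℝ} (hB : 2 < B) (hc : ∀ n, 1 ≤ n → B ≤ c n)
    (w : List Bool) :
    ∀ (w' : List Bool) (n : ℕ) (st : ℝ × ℝ) (x y : ℝ), 1 ≤ n → 0 ≤ st.2 →
      w.length = w'.length → w ≠ w' →
      x ∈ Icc (moranCyl c w n st).1 ((moranCyl c w n st).1 + (moranCyl c w n st).2) →
      y ∈ Icc (moranCyl c w' n st).1 ((moranCyl c w' n st).1 + (moranCyl c w' n st).2) →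
      (1 - 2 / B) * (moranCyl c w n st).2 ≤ |x - y| := by
  have hc2 : ∀ n, 1 ≤ n → 2 < c n := fun n hn => hB.trans_le (hc n hn)
  have hB1 : 0 ≤ 1 - 2 / B := by
    rw [sub_nonneg, div_le_one (by linarith)]; exact hB.le
  induction w with
  | nil =>
    intro w' n st x y _ _ hl hne
    exact absurd (List.length_eq_zero_iff.1 hl.symm).symm hne
  | cons b w ih =>
    rintro (_ | ⟨b', w'⟩) n st x y hn hst hl hne hx hy
    · simp at hl
    have hcn := hc n hn
    have h0 : 0 ≤ st.2 / c n := div_nonneg hst (by linarith)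
    by_cases hbb : b = b'
    · subst hbb
      refine ih w' (n + 1) _ x y (by omega) ?_ (by simpa using hl) (by simpa using hne) hx hy
      split_ifs <;> exact h0
    · have hlen : (moranCyl c (b :: w) n st).2 ≤ st.2 := by
        have := moranCyl_subset hc2 (b :: w) n st hn hst
        linarith
      have hgap : (1 - 2 / B) * st.2 ≤ st.2 - 2 * (st.2 / c n) := by
        have : st.2 / c n ≤ st.2 / B := div_le_div_of_nonneg_left hst (by linarith) hcn
        have e : (1 - 2 / B) * st.2 = st.2 - 2 * (st.2 / B) := by ring
        linarith
      refine le_trans (mul_le_mul_of_nonneg_left hlen hB1) (hgap.trans ?_)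
      have f0 := fun v => moranCyl_subset hc2 v (n + 1) (st.1, st.2 / c n) (by omega) h0
      have f1 := fun v => moranCyl_subset hc2 v (n + 1)
        (st.1 + st.2 - st.2 / c n, st.2 / c n) (by omega) h0
      cases b <;> cases b' <;>
        simp only [moranCyl, Bool.false_eq_true, if_false, if_true, mem_Icc, not_true] at hx hy hbb
      · have := f0 w; have := f1 w'; simp only at *
        rw [abs_sub_comm]; exact le_trans (by linarith) (le_abs_self _)
      · have := f1 w; have := f0 w'; simp only at *
        exact le_trans (by linarith) (le_abs_self _)

lemma pairwiseDisjoint_moranI {c : ℕ → ℝ} {B : ℝ} (hB : 2 < B) (hc : ∀ n, 1 ≤ n → B ≤ c n)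
    (n : ℕ) : (↑(binaryWords n) : Set (List Bool)).PairwiseDisjoint (moranI c) := by
  intro w hw w' hw' hne
  rw [Finset.mem_coe, mem_binaryWords] at hw hw'
  refine Set.disjoint_left.2 fun x hx hx' => ?_
  have h := moranCyl_separated hB hc w w' 1 (0, 1) x x le_rfl zero_le_one (hw.trans hw'.symm)
    hne hx hx'
  rw [moranLen_eq (fun n hn => by linarith [hc n hn]), sub_self, abs_zero] at h
  have : 0 < 1 - 2 / B := by rw [sub_pos, div_lt_one (by linarith)]; exact hB
  exact absurd h (not_le.2 (mul_pos this (Real.exp_pos _)))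

section MoranMeasure

variable {c r : ℕ → ℝ} {B ρ : ℝ} {μ : Measure ℝ}

lemma ae_mem_iUnion_moranI [IsProbabilityMeasure μ] (hB : 2 < B) (hc : ∀ n, 1 ≤ n → B ≤ c n)
    (hr : ∀ n, 1 ≤ n → 0 < r n ∧ r n < 1)
    (hμ : ∀ w : List Bool, μ (moranI c w) = ENNReal.ofReal (cylMass r w 1 1)) (n : ℕ) :
    ∀ᵐ x ∂μ, x ∈ ⋃ w ∈ binaryWords n, moranI c w := by
  have hmeas : ∀ w ∈ binaryWords n, MeasurableSet (moranI c w) := fun w _ => measurableSet_Icc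
  have hsum := sum_cylMass_rpow hr 1 n 1 1 le_rfl one_pos
  simp only [Real.rpow_one, one_mul, add_sub_cancel, Finset.prod_const_one] at hsum
  refine (mem_ae_iff_prob_eq_one (Finset.measurableSet_biUnion _ hmeas)).2 ?_
  rw [measure_biUnion_finset (pairwiseDisjoint_moranI hB hc n) hmeas]
  simp only [hμ]
  rw [← ENNReal.ofReal_sum_of_nonneg fun w _ => (cylMass_pos hr w 1 1 le_rfl one_pos).le, hsum,
    ENNReal.ofReal_one]

lemma ae_eventually_lt_deviation (hρ : 0 < ρ) (hr : ∀ n, 1 ≤ n → ρ ≤ r n ∧ r n ≤ 1 - ρ)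
    (hμ : ∀ w : List Bool, μ (moranI c w) = ENNReal.ofReal (cylMass r w 1 1)) {s ε : ℝ}
    (hs : |s| * -Real.log ρ ≤ 1) (hsε : s ^ 2 * Real.log ρ ^ 2 < |s| * ε) :
    ∀ᵐ x ∂μ, ∀ᶠ n : ℕ in atTop, ∀ w ∈ binaryWords n, x ∈ moranI c w →
      s * (Real.log (cylMass r w 1 1) + entropySum r n) < |s| * (ε * n) := by
  set θ := Real.exp (s ^ 2 * Real.log ρ ^ 2 - |s| * ε) with hθ
  have hθ1 : θ < 1 := Real.exp_lt_one_iff.2 (by linarith)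
  have hr' : ∀ n, 1 ≤ n → 0 < r n ∧ r n < 1 := fun n hn => by
    have := hr n hn; constructor <;> linarith
  let bad : ℕ → Finset (List Bool) := fun n => (binaryWords n).filter fun w =>
    |s| * (ε * n) ≤ s * (Real.log (cylMass r w 1 1) + entropySum r n)
  have hle : ∀ n, μ (⋃ w ∈ bad n, moranI c w) ≤ ENNReal.ofReal (θ ^ n) := by
    intro n
    refine (measure_biUnion_finset_le _ _).trans ?_
    simp only [hμ]
    rw [← ENNReal.ofReal_sum_of_nonneg fun w _ => (cylMass_pos hr' w 1 1 le_rfl one_pos).le]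
    exact ENNReal.ofReal_le_ofReal (sum_cylMass_deviation_le hρ hr hs n)
  have hsum : ∑' n, μ (⋃ w ∈ bad n, moranI c w) ≠ ⊤ :=
    ne_top_of_le_ne_top
      (summable_geometric_of_lt_one (Real.exp_pos _).le hθ1).tsum_ofReal_ne_top
      (ENNReal.tsum_le_tsum hle)
  filter_upwards [ae_eventually_notMem hsum] with x hx
  filter_upwards [hx] with n hn w hw hxw
  by_contra! hcon
  exact hn (mem_iUnion₂.2 ⟨w, Finset.mem_filter.2 ⟨hw, hcon⟩, hxw⟩)

lemma ae_eventually_abs_log_cylMass_le (hρ : 0 < ρ) (hρ1 : ρ < 1)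
    (hr : ∀ n, 1 ≤ n → ρ ≤ r n ∧ r n ≤ 1 - ρ)
    (hμ : ∀ w : List Bool, μ (moranI c w) = ENNReal.ofReal (cylMass r w 1 1)) :
    ∀ᵐ x ∂μ, ∀ ε : ℝ, 0 < ε → ∀ᶠ n : ℕ in atTop, ∀ w ∈ binaryWords n, x ∈ moranI c w →
      |Real.log (cylMass r w 1 1) + entropySum r n| ≤ ε * n := by
  have hL : 0 < -Real.log ρ := neg_pos.2 (Real.log_neg hρ hρ1)
  have hfix : ∀ k : ℕ, ∀ᵐ x ∂μ, ∀ᶠ n : ℕ in atTop, ∀ w ∈ binaryWords n, x ∈ moranI c w →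
      |Real.log (cylMass r w 1 1) + entropySum r n| ≤ 1 / ((k : ℝ) + 1) * n := by
    intro k
    set ε : ℝ := 1 / ((k : ℝ) + 1) with hε
    have hε0 : 0 < ε := by positivity
    set s : ℝ := min (1 / -Real.log ρ) (ε / (2 * Real.log ρ ^ 2)) with hs
    have hL2 : 0 < Real.log ρ ^ 2 := by nlinarith
    have hs0 : 0 < s := lt_min (by positivity) (by positivity)
    have hs1 : s * -Real.log ρ ≤ 1 := (le_div_iff₀ hL).1 (min_le_left _ _)
    have hs2 : s * (2 * Real.log ρ ^ 2) ≤ ε := (le_div_iff₀ (by positivity)).1 (min_le_right _ _)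
    have hs3 : s ^ 2 * Real.log ρ ^ 2 < s * ε := by
      have : s * (s * Real.log ρ ^ 2) < s * ε :=
        mul_lt_mul_of_pos_left (by nlinarith [mul_pos hs0 hL2]) hs0
      nlinarith
    have habs : |s| = s := abs_of_pos hs0
    have habs' : |-s| = s := by rw [abs_neg, habs]
    filter_upwards [ae_eventually_lt_deviation (s := s) (ε := ε) hρ hr hμ
        (by rwa [habs]) (by rwa [habs]),
      ae_eventually_lt_deviation (s := -s) (ε := ε) hρ hr hμ
        (by rwa [habs']) (by rwa [habs', neg_sq])] with x h1 h2
    filter_upwards [h1, h2] with n h1 h2 w hw hxw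
    have h1 := h1 w hw hxw
    have h2 := h2 w hw hxw
    rw [habs] at h1
    rw [habs', neg_mul, ← mul_neg] at h2
    exact abs_le'.2 ⟨(lt_of_mul_lt_mul_left h1 hs0.le).le, (lt_of_mul_lt_mul_left h2 hs0.le).le⟩
  filter_upwards [ae_all_iff.2 hfix] with x hx ε hε
  obtain ⟨k, hk⟩ := exists_nat_one_div_lt hε
  filter_upwards [hx k] with n hn w hw hxw
  exact (hn w hw hxw).trans (mul_le_mul_of_nonneg_right hk.le n.cast_nonneg)

lemma cylMass_le_measure_closedBall [IsProbabilityMeasure μ] (hc : ∀ n, 1 ≤ n → 0 < c n)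
    (hμ : ∀ w : List Bool, μ (moranI c w) = ENNReal.ofReal (cylMass r w 1 1))
    {n : ℕ} {w : List Bool} (hw : w ∈ binaryWords n) {x R : ℝ} (hx : x ∈ moranI c w)
    (hR : Real.exp (-logLen c n) ≤ R) :
    cylMass r w 1 1 ≤ (μ (closedBall x R)).toReal := by
  have hsub : moranI c w ⊆ closedBall x R := by
    intro y hy
    rw [← mem_binaryWords.1 hw, ← moranLen_eq hc] at hR
    rw [mem_closedBall, Real.dist_eq, abs_le]
    simp only [moranI, mem_Icc] at hx hy
    constructor <;> linarith
  refine (ENNReal.ofReal_le_iff_le_toReal (measure_ne_top _ _)).1 ?_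
  rw [← hμ]
  exact measure_mono hsub

lemma measure_closedBall_le_cylMass [IsProbabilityMeasure μ] (hB : 2 < B) (hc : ∀ n, 1 ≤ n → B ≤ c n)
    (hr : ∀ n, 1 ≤ n → 0 < r n ∧ r n < 1)
    (hμ : ∀ w : List Bool, μ (moranI c w) = ENNReal.ofReal (cylMass r w 1 1))
    {n : ℕ} {w : List Bool} (hw : w ∈ binaryWords n) {x R : ℝ} (hx : x ∈ moranI c w)
    (hR : R < (1 - 2 / B) * Real.exp (-logLen c n)) :
    (μ (closedBall x R)).toReal ≤ cylMass r w 1 1 := by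
  refine ENNReal.toReal_le_of_le_ofReal (cylMass_pos hr w 1 1 le_rfl one_pos).le ?_
  rw [← hμ]
  refine measure_mono_ae ?_
  filter_upwards [ae_mem_iUnion_moranI hB hc hr hμ n] with y hy hyR
  obtain ⟨w', hw', hyw'⟩ := mem_iUnion₂.1 hy
  suffices h : w = w' from h ▸ hyw'
  by_contra hne
  have h := moranCyl_separated hB hc w w' 1 (0, 1) x y le_rfl zero_le_one
    ((mem_binaryWords.1 hw).trans (mem_binaryWords.1 hw').symm) hne hx hyw'
  rw [moranLen_eq (fun n hn => by linarith [hc n hn]), mem_binaryWords.1 hw] at h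
  have hd : dist y x ≤ R := hyR
  rw [Real.dist_eq, abs_sub_comm] at hd
  linarith

end MoranMeasure

lemma logLen_bounds {c : ℕ → ℝ} {A B : ℝ} (hB : 0 < B) (hc : ∀ n, 1 ≤ n → B ≤ c n ∧ c n ≤ A)
    (n : ℕ) : n * Real.log B ≤ logLen c n ∧ logLen c (n + 1) ≤ logLen c n + Real.log A := by
  constructor
  · rw [logLen, ← nsmul_eq_mul]
    refine (Finset.card_nsmul_le_sum _ _ _ fun k _ =>
      Real.log_le_log hB (hc (1 + k) (by omega)).1).trans_eq' (by simp)
  · rw [logLen, Finset.sum_range_succ, ← logLen]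
    have := hc (1 + n) (by omega)
    gcongr
    · linarith
    · exact this.2

lemma limsup_eq_of_forall_pos {α : Type*} {l : Filter α} [l.NeBot] {f : α → ℝ} {d : ℝ}
    (h0 : ∀ᶠ a in l, 0 ≤ f a)
    (h1 : ∀ ε : ℝ, 0 < ε → ∀ᶠ a in l, f a ≤ d + ε)
    (h2 : ∀ ε : ℝ, 0 < ε → ∃ᶠ a in l, d - ε ≤ f a) : limsup f l = d := by
  have hbdd : l.IsBoundedUnder (· ≤ ·) f := isBoundedUnder_of_eventually_le (h1 1 one_pos)
  have hcob : l.IsCoboundedUnder (· ≤ ·) f :=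
    (isBoundedUnder_of_eventually_ge h0).isCoboundedUnder_le
  refine le_antisymm (le_of_forall_pos_le_add fun ε hε => limsup_le_of_le hcob (h1 ε hε))
    (le_of_forall_pos_le_add fun ε hε => ?_)
  have := le_limsup_of_frequently_le (h2 ε hε) hbdd
  linarith

section UpperLocalDim

variable {c r : ℕ → ℝ} {A B d x : ℝ} {μ : Measure ℝ} [IsProbabilityMeasure μ]

lemma eventually_localDim_quotient_le (hB : 2 < B) (hc : ∀ n, 1 ≤ n → B ≤ c n ∧ c n ≤ A)
    (hr : ∀ n, 1 ≤ n → 0 < r n ∧ r n < 1)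
    (hμ : ∀ w : List Bool, μ (moranI c w) = ENNReal.ofReal (cylMass r w 1 1))
    (hd : 0 ≤ d) (hdS : ∀ n, entropySum r n ≤ d * logLen c n)
    (hx : ∀ n, ∃ w ∈ binaryWords n, x ∈ moranI c w)
    (hdev : ∀ ε : ℝ, 0 < ε → ∀ᶠ n : ℕ in atTop, ∀ w ∈ binaryWords n, x ∈ moranI c w →
      |Real.log (cylMass r w 1 1) + entropySum r n| ≤ ε * n) {ε : ℝ} (hε : 0 < ε) :
    ∀ᶠ R in 𝓝[>] 0, Real.log (μ (closedBall x R)).toReal / Real.log R ≤ d + ε := by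
  have hlB : 0 < Real.log B := Real.log_pos (by linarith)
  have hη : 0 < ε * Real.log B / 2 := by positivity
  obtain ⟨K₁, hK₁⟩ := eventually_atTop.1 (hdev _ hη)
  obtain ⟨K₂, hK₂⟩ := exists_nat_ge ((d + ε) * Real.log A / (ε * Real.log B / 2))
  rw [div_le_iff₀ hη] at hK₂
  set K := max K₁ K₂
  have hmono : Monotone (logLen c) := by
    refine monotone_nat_of_le_succ fun n => ?_
    rw [logLen, logLen, Finset.sum_range_succ]
    have := hc (1 + n) (by omega)
    have := Real.log_nonneg (show 1 ≤ c (1 + n) by linarith)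
    linarith
  have hlt : (0 : ℝ) < min 1 (Real.exp (-logLen c K)) := lt_min one_pos (Real.exp_pos _)
  filter_upwards [Ioo_mem_nhdsGT hlt] with R hR
  obtain ⟨hR0, hR⟩ := hR
  have hR1 : R < 1 := hR.trans_le (min_le_left _ _)
  have hRK : R < Real.exp (-logLen c K) := hR.trans_le (min_le_right _ _)
  have hlR : Real.log R < 0 := Real.log_neg hR0 hR1
  have hex : ∃ n, Real.exp (-logLen c n) ≤ R := by
    obtain ⟨n, hn⟩ := exists_nat_ge (-Real.log R / Real.log B)
    rw [div_le_iff₀ hlB] at hn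
    refine ⟨n, ?_⟩
    rw [← Real.le_log_iff_exp_le hR0]
    have := (logLen_bounds (by linarith) hc n).1
    linarith
  classical
  have hn := Nat.find_spec hex
  have hmin := fun m => Nat.find_min hex (m := m)
  set n := Nat.find hex
  have hKn : K < n := by
    by_contra! h
    have := Real.exp_le_exp.2 (neg_le_neg (hmono h))
    linarith
  obtain ⟨m, hm⟩ : ∃ m, n = m + 1 := ⟨n - 1, by omega⟩
  have hRm : R < Real.exp (-logLen c m) := not_le.1 (hmin m (by omega))
  have hlRm : Real.log R < -logLen c m := by rwa [← Real.log_lt_iff_lt_exp hR0] at hRm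
  obtain ⟨w, hw, hxw⟩ := hx n
  have hdev' := (abs_le.1 (hK₁ n (le_trans (le_max_left _ _) hKn.le) w hw hxw)).1
  have hball := cylMass_le_measure_closedBall (fun n hn => by linarith [hc n hn]) hμ hw hxw hn
  have hlog := Real.log_le_log (cylMass_pos hr w 1 1 le_rfl one_pos) hball
  have hb := logLen_bounds (by linarith) hc m
  rw [← hm] at hb
  have hb' := (logLen_bounds (by linarith) hc n).1
  have hdSn := hdS n
  have hKn' : (K₂ : ℝ) ≤ n := by exact_mod_cast le_trans (le_max_right _ _) hKn.le
  have hKη := mul_le_mul_of_nonneg_right hKn' hη.le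
  rw [div_le_iff_of_neg hlR]
  have e1 : (d + ε) * Real.log R ≤ (d + ε) * (Real.log A - logLen c n) :=
    mul_le_mul_of_nonneg_left (by linarith) (by linarith)
  have e2 := mul_le_mul_of_nonneg_left hb' hε.le
  nlinarith

lemma frequently_le_localDim_quotient (hB : 2 < B) (hc : ∀ n, 1 ≤ n → B ≤ c n ∧ c n ≤ A)
    (hr : ∀ n, 1 ≤ n → 0 < r n ∧ r n < 1)
    (hμ : ∀ w : List Bool, μ (moranI c w) = ENNReal.ofReal (cylMass r w 1 1))
    (hdS : ∀ ε : ℝ, 0 < ε → ∃ᶠ n : ℕ in atTop, d * logLen c n ≤ entropySum r n + ε * n)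
    (hx : ∀ n, ∃ w ∈ binaryWords n, x ∈ moranI c w)
    (hdev : ∀ ε : ℝ, 0 < ε → ∀ᶠ n : ℕ in atTop, ∀ w ∈ binaryWords n, x ∈ moranI c w →
      |Real.log (cylMass r w 1 1) + entropySum r n| ≤ ε * n) {ε : ℝ} (hε : 0 < ε) :
    ∃ᶠ R in 𝓝[>] 0, d - ε ≤ Real.log (μ (closedBall x R)).toReal / Real.log R := by
  have hlB : 0 < Real.log B := Real.log_pos (by linarith)
  have hη : 0 < ε * Real.log B / 4 := by positivity
  have hgap : 0 < 1 - 2 / B := by rw [sub_pos, div_lt_one (by linarith)]; exact hB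
  have hgap1 : 1 - 2 / B < 1 := by
    have : 0 < 2 / B := by positivity
    linarith
  set δ := (1 - 2 / B) / 2 with hδ
  have hδ0 : 0 < δ := by positivity
  have hlδ : Real.log δ < 0 := Real.log_neg hδ0 (by linarith)
  have hS : Tendsto (logLen c) atTop atTop :=
    tendsto_atTop_mono (fun n => (logLen_bounds (by linarith) hc n).1)
      (tendsto_natCast_atTop_atTop.atTop_mul_const hlB)
  have hradius : Tendsto (fun n => δ * Real.exp (-logLen c n)) atTop (𝓝[>] 0) := by
    refine tendsto_nhdsWithin_iff.2 ⟨?_, Eventually.of_forall fun n => by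
      simp only [mem_Ioi]; positivity⟩
    simpa using (Real.tendsto_exp_neg_atTop_nhds_zero.comp hS).const_mul δ
  refine hradius.frequently ?_
  obtain ⟨K, hK⟩ := exists_nat_ge (d * -Real.log δ / (ε * Real.log B / 2))
  rw [div_le_iff₀ (by positivity)] at hK
  refine ((hdS _ hη).and_eventually ((hdev _ hη).and (eventually_ge_atTop K))).mono ?_
  rintro n ⟨hdSn, hdevn, hKn⟩
  set R := δ * Real.exp (-logLen c n) with hR
  have hR0 : 0 < R := by positivity
  have hlR : Real.log R = Real.log δ - logLen c n := by
    rw [hR, Real.log_mul hδ0.ne' (Real.exp_pos _).ne', Real.log_exp]; ring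
  have hb := (logLen_bounds (by linarith) hc n).1
  have hlR0 : Real.log R < 0 := by
    have : 0 ≤ (n : ℝ) * Real.log B := by positivity
    rw [hlR]; linarith
  obtain ⟨w, hw, hxw⟩ := hx n
  have hdev' := (abs_le.1 (hdevn w hw hxw)).2
  have hball := measure_closedBall_le_cylMass hB (fun n hn => (hc n hn).1) hr hμ hw hxw
    (R := R) (by rw [hR]; exact mul_lt_mul_of_pos_right (by linarith) (Real.exp_pos _))
  have hpos : 0 < (μ (closedBall x R)).toReal := by
    obtain ⟨m, hm⟩ := (hS.eventually_ge_atTop (-Real.log R)).exists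
    obtain ⟨v, hv, hxv⟩ := hx m
    refine (cylMass_pos hr v 1 1 le_rfl one_pos).trans_le
      (cylMass_le_measure_closedBall (fun n hn => by linarith [hc n hn]) hμ hv hxv ?_)
    rw [← Real.le_log_iff_exp_le hR0]
    linarith
  have hlog := Real.log_le_log hpos hball
  have hKn' : (K : ℝ) ≤ n := by exact_mod_cast hKn
  have hKη := mul_le_mul_of_nonneg_right hKn' (show 0 ≤ ε * Real.log B / 2 by positivity)
  rw [le_div_iff_of_neg hlR0, hlR]
  have e2 := mul_le_mul_of_nonneg_left hb hε.le
  have e3 := mul_pos hε (neg_pos.2 hlδ)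
  nlinarith

lemma upperLocalDim_eq (hB : 2 < B) (hc : ∀ n, 1 ≤ n → B ≤ c n ∧ c n ≤ A)
    (hr : ∀ n, 1 ≤ n → 0 < r n ∧ r n < 1)
    (hμ : ∀ w : List Bool, μ (moranI c w) = ENNReal.ofReal (cylMass r w 1 1))
    (hd : 0 ≤ d) (hdS : ∀ n, entropySum r n ≤ d * logLen c n)
    (hdS' : ∀ ε : ℝ, 0 < ε → ∃ᶠ n : ℕ in atTop, d * logLen c n ≤ entropySum r n + ε * n)
    (hx : ∀ n, ∃ w ∈ binaryWords n, x ∈ moranI c w)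
    (hdev : ∀ ε : ℝ, 0 < ε → ∀ᶠ n : ℕ in atTop, ∀ w ∈ binaryWords n, x ∈ moranI c w →
      |Real.log (cylMass r w 1 1) + entropySum r n| ≤ ε * n) :
    upperLocalDim μ x = d := by
  refine limsup_eq_of_forall_pos ?_
    (fun ε hε => eventually_localDim_quotient_le hB hc hr hμ hd hdS hx hdev hε)
    (fun ε hε => frequently_le_localDim_quotient hB hc hr hμ hdS' hx hdev hε)
  filter_upwards [Ioo_mem_nhdsGT (zero_lt_one (α := ℝ))] with R hR
  refine div_nonneg_of_nonpos (Real.log_nonpos ENNReal.toReal_nonneg ?_)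
    (Real.log_neg hR.1 hR.2).le
  exact ENNReal.toReal_le_of_le_ofReal zero_le_one (by simpa using prob_le_one)

end UpperLocalDim

lemma exists_block {N : ℕ → ℕ} (hN0 : N 0 = 0) (hN : StrictMono N) {n : ℕ} (hn : 1 ≤ n) :
    ∃ j, N j < n ∧ n ≤ N (j + 1) := by
  classical
  have hex : ∃ j, n ≤ N j := ⟨n, hN.id_le n⟩
  have h := Nat.find_spec hex
  have hmin := fun m => Nat.find_min hex (m := m)
  obtain ⟨j, hj⟩ : ∃ j, Nat.find hex = j + 1 := by
    refine Nat.exists_eq_succ_of_ne_zero fun h0 => ?_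
    rw [h0, hN0] at h
    omega
  exact ⟨j, not_le.1 (hmin j (by omega)), hj ▸ h⟩

lemma binEntropy_bounds {x : ℝ} (h0 : 0 < x) (h2 : x ≤ 1 / 2) :
    -Real.log (1 - x) ≤ Real.binEntropy x ∧ Real.binEntropy x ≤ -Real.log x := by
  have h := Real.log_le_log h0 (show x ≤ 1 - x by linarith)
  simp only [Real.binEntropy, Real.log_inv]
  constructor <;> nlinarith

/-- for μ-almost every x ∈ X = supp(μ), the upper local dimension equals
H(q)/log B, where H(q) = −q log q − (1−q) log(1−q). -/
theorem stmt_4 (A B p q : ℝ) (N : ℕ → ℕ)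
    (hBA : B < A) (hB2 : 2 < B)
    (hp0 : 0 < p) (hp2 : p ≤ 1 / 2) (hq0 : 0 < q) (hq2 : q ≤ 1 / 2)
    (hN0 : N 0 = 0) (hNmono : StrictMono N)
    (hNlim : Tendsto (fun i : ℕ => (N (i + 1) : ℝ) / (N i : ℝ)) atTop atTop)
    (hpq : -Real.log p / Real.log A < -Real.log (1 - q) / Real.log B)
    (c r : ℕ → ℝ)
    (hcA : ∀ i n : ℕ, N (2 * i) < n → n ≤ N (2 * i + 1) → c n = A)
    (hcB : ∀ i n : ℕ, N (2 * i + 1) < n → n ≤ N (2 * i + 2) → c n = B)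
    (hrp : ∀ i n : ℕ, N (2 * i) < n → n ≤ N (2 * i + 1) → r n = p)
    (hrq : ∀ i n : ℕ, N (2 * i + 1) < n → n ≤ N (2 * i + 2) → r n = q)
    (μ : Measure ℝ) [IsProbabilityMeasure μ]
    (hμ : ∀ w : List Bool, μ (moranI c w) = ENNReal.ofReal (cylMass r w 1 1))
    :
    ∀ᵐ x ∂μ, upperLocalDim μ x =
      (-(q * Real.log q) - (1 - q) * Real.log (1 - q)) / Real.log B := by
  have hB0 : 0 < B := by linarith
  have hlB : 0 < Real.log B := Real.log_pos (by linarith)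
  have hlA : 0 < Real.log A := Real.log_pos (by linarith)
  set d := Real.binEntropy q / Real.log B with hd
  have hdB : d * Real.log B = Real.binEntropy q := div_mul_cancel₀ _ hlB.ne'
  have hd0 : 0 ≤ d := div_nonneg (Real.binEntropy_nonneg hq0.le (by linarith)) hlB.le
  have hdA : Real.binEntropy p ≤ d * Real.log A := by
    rw [← div_le_iff₀ hlA]
    calc Real.binEntropy p / Real.log A ≤ -Real.log p / Real.log A := by
          gcongr; exact (binEntropy_bounds hp0 hp2).2
      _ ≤ -Real.log (1 - q) / Real.log B := hpq.le
      _ ≤ d := by rw [hd]; gcongr; exact (binEntropy_bounds hq0 hq2).1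
  have hcases : ∀ n, 1 ≤ n → c n = A ∧ r n = p ∨ c n = B ∧ r n = q := by
    intro n hn
    obtain ⟨j, hj1, hj2⟩ := exists_block hN0 hNmono hn
    obtain ⟨i, rfl | rfl⟩ := Nat.even_or_odd' j
    · exact Or.inl ⟨hcA i n hj1 hj2, hrp i n hj1 hj2⟩
    · exact Or.inr ⟨hcB i n hj1 hj2, hrq i n hj1 hj2⟩
  have hc : ∀ n, 1 ≤ n → B ≤ c n ∧ c n ≤ A := by
    intro n hn
    rcases hcases n hn with h | h <;> rw [h.1]
    · exact ⟨hBA.le, le_rfl⟩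
    · exact ⟨le_rfl, hBA.le⟩
  have hρ : 0 < min p q := lt_min hp0 hq0
  have hρ1 : min p q < 1 := (min_le_left p q).trans_lt (by linarith)
  have hrρ : ∀ n, 1 ≤ n → min p q ≤ r n ∧ r n ≤ 1 - min p q := by
    intro n hn
    have h1 := min_le_left p q
    have h2 := min_le_right p q
    rcases hcases n hn with h | h <;> rw [h.2] <;> constructor <;> linarith
  have hr : ∀ n, 1 ≤ n → 0 < r n ∧ r n < 1 := fun n hn => by
    have := hrρ n hn; constructor <;> linarith
  have hterm : ∀ n, 1 ≤ n → Real.binEntropy (r n) ≤ d * Real.log (c n) := by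
    intro n hn
    rcases hcases n hn with h | h <;> rw [h.1, h.2]
    · exact hdA
    · exact hdB.ge
  have hdS : ∀ n, entropySum r n ≤ d * logLen c n := by
    intro n
    rw [entropySum, logLen, Finset.mul_sum]
    exact Finset.sum_le_sum fun k _ => hterm (1 + k) (by omega)
  have hblock : ∀ i, d * logLen c (N (2 * i + 2)) ≤
      entropySum r (N (2 * i + 2)) + N (2 * i + 1) * (d * Real.log A) := by
    intro i
    obtain ⟨m, hm⟩ := Nat.exists_eq_add_of_le (hNmono.monotone (show 2 * i + 1 ≤ 2 * i + 2 by omega))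
    rw [logLen, entropySum, Finset.mul_sum, hm, Finset.sum_range_add, Finset.sum_range_add]
    have h1 : ∑ k ∈ Finset.range (N (2 * i + 1)), d * Real.log (c (1 + k)) ≤
        ∑ k ∈ Finset.range (N (2 * i + 1)), Real.binEntropy (r (1 + k)) +
          N (2 * i + 1) * (d * Real.log A) := by
      calc _ ≤ ∑ k ∈ Finset.range (N (2 * i + 1)),
            (Real.binEntropy (r (1 + k)) + d * Real.log A) := by
            refine Finset.sum_le_sum fun k _ => ?_
            have h := hc (1 + k) (by omega)
            have h' := hr (1 + k) (by omega)
            have := Real.binEntropy_nonneg h'.1.le h'.2.le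
            have := mul_le_mul_of_nonneg_left (Real.log_le_log (by linarith) h.2) hd0
            linarith
        _ = _ := by simp [Finset.sum_add_distrib]
    have h2 : ∑ k ∈ Finset.range m, d * Real.log (c (1 + (N (2 * i + 1) + k))) =
        ∑ k ∈ Finset.range m, Real.binEntropy (r (1 + (N (2 * i + 1) + k))) := by
      refine Finset.sum_congr rfl fun k hk => ?_
      rw [Finset.mem_range] at hk
      rw [hcB i _ (by omega) (by omega), hrq i _ (by omega) (by omega), hdB]
    linarith
  have hdS' : ∀ ε : ℝ, 0 < ε →
      ∃ᶠ n : ℕ in atTop, d * logLen c n ≤ entropySum r n + ε * n := by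
    intro ε hε
    have hsub : Tendsto (fun i : ℕ => 2 * i + 1) atTop atTop :=
      tendsto_atTop_mono (fun i => by simp only [id]; omega) tendsto_id
    have hsub' : Tendsto (fun i : ℕ => N (2 * i + 2)) atTop atTop :=
      hNmono.tendsto_atTop.comp (tendsto_atTop_mono (fun i => by simp only [id]; omega) tendsto_id)
    refine hsub'.frequently (Eventually.frequently ?_)
    filter_upwards [(hNlim.comp hsub).eventually_ge_atTop (d * Real.log A / ε)] with i hi
    have hpos : (0 : ℝ) < N (2 * i + 1) := by
      have := hNmono (show 0 < 2 * i + 1 by omega)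
      exact_mod_cast (Nat.zero_le _).trans_lt this
    simp only [Function.comp_apply] at hi
    rw [div_le_div_iff₀ hε hpos] at hi
    have := hblock i
    linarith
  have hgoal : (-(q * Real.log q) - (1 - q) * Real.log (1 - q)) / Real.log B = d := by
    rw [hd]
    simp only [Real.binEntropy, Real.log_inv]
    ring
  rw [hgoal]
  filter_upwards [ae_all_iff.2 (ae_mem_iUnion_moranI hB2 (fun n hn => (hc n hn).1) hr hμ),
    ae_eventually_abs_log_cylMass_le hρ hρ1 hrρ hμ] with x hx hdev
  exact upperLocalDim_eq hB2 hc hr hμ hd0 hdS hdS'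
    (fun n => by simpa only [mem_iUnion, exists_prop] using hx n) hdev
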